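/- Let X and Y be complex Banach spaces, A ∈ B(X), B ∈ B(Y), C ∈ B(Y, X), and let M_C ∈ B(X ⊕ Y) be the upper-triangular operator matrix M_C(x, y) = (Ax + Cy, By). Then σ_D(M_C) ∪ (S(A*) ∩ S(B)) = σ_D(A) ∪ σ_D(B), where σ_D denotes the Drazin spectrum, A* the Banach-space adjoint of A, and S(T) the set of points where T fails to have the single valued extension property. -/

import Mathlib

noncomputable section

open ContinuousLinearMap Metric Set

variable {E : Type*} [NormedAddCommGroup E] [NormedSpace ℂ E]
variable {X Y : Type*} [NormedAddCommGroup X] [NormedSpace ℂ X] [CompleteSpace X]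
  [NormedAddCommGroup Y] [NormedSpace ℂ Y] [CompleteSpace Y]

/-- `T` is Drazin invertible. -/
def IsDrazinInvertible (T : E →L[ℂ] E) : Prop :=
  ∃ S : E →L[ℂ] E, ∃ k : ℕ, T * S = S * T ∧ S * T * S = S ∧ T ^ (k + 1) * S = T ^ k

/-- The Drazin spectrum. -/
def drazinSpectrum (T : E →L[ℂ] E) : Set ℂ :=
  {z | ¬ IsDrazinInvertible (T - z • 1)}

/-- `T` has the single valued extension property at `z₀`. -/
def HasSVEPAt (T : E →L[ℂ] E) (z₀ : ℂ) : Prop :=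
  ∃ r > (0 : ℝ), ∀ V : Set ℂ, V ⊆ ball z₀ r → IsOpen V →
    ∀ f : ℂ → E, AnalyticOnNhd ℂ f V → (∀ z ∈ V, (T - z • 1) (f z) = 0) →
      ∀ z ∈ V, f z = 0

/-- `S(T)`: the set of points where `T` fails to have the SVEP. -/
def svepFail (T : E →L[ℂ] E) : Set ℂ :=
  {z | ¬ HasSVEPAt T z}

/-- The Banach-space adjoint (dual map) of `T`, acting on the continuous dual. -/
def dualOp (T : E →L[ℂ] E) : (E →L[ℂ] ℂ) →L[ℂ] (E →L[ℂ] ℂ) :=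
  (ContinuousLinearMap.compL ℂ E E ℂ).flip T

/-- The upper-triangular operator matrix `M_C (x, y) = (A x + C y, B y)` on `X ⊕ Y`. -/
def ucMat (A : X →L[ℂ] X) (B : Y →L[ℂ] Y) (C : Y →L[ℂ] X) :
    (X × Y) →L[ℂ] (X × Y) :=
  (A.comp (ContinuousLinearMap.fst ℂ X Y) + C.comp (ContinuousLinearMap.snd ℂ X Y)).prod
    (B.comp (ContinuousLinearMap.snd ℂ X Y))

/-- Iterating `a^n = a^(n+1) u`. -/
theorem pow_right_iter {R : Type*} [Ring R] {a u : R} {n : ℕ} (h : a ^ n = a ^ (n + 1) * u)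
    (j : ℕ) : a ^ n = a ^ (n + j) * u ^ j := by
  induction j with
  | zero => simp
  | succ j ih =>
    calc a ^ n = a ^ (n + j) * u ^ j := ih
      _ = a ^ j * a ^ n * u ^ j := by rw [← pow_add, add_comm j n]
      _ = a ^ j * (a ^ (n + 1) * u) * u ^ j := by rw [← h]
      _ = a ^ j * a ^ (n + 1) * (u * u ^ j) := by simp only [mul_assoc]
      _ = a ^ (n + (j + 1)) * u ^ (j + 1) := by
        rw [← pow_add, ← pow_succ']; congr 2; omega

/-- Iterating `a^n = v a^(n+1)`. -/
theorem pow_left_iter {R : Type*} [Ring R] {a v : R} {n : ℕ} (h : a ^ n = v * a ^ (n + 1))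
    (j : ℕ) : a ^ n = v ^ j * a ^ (n + j) := by
  induction j with
  | zero => simp
  | succ j ih =>
    calc a ^ n = v ^ j * a ^ (n + j) := ih
      _ = v ^ j * (a ^ n * a ^ j) := by rw [← pow_add]
      _ = v ^ j * (v * a ^ (n + 1) * a ^ j) := by rw [← h]
      _ = (v ^ j * v) * (a ^ (n + 1) * a ^ j) := by simp only [mul_assoc]
      _ = v ^ (j + 1) * a ^ (n + (j + 1)) := by
        rw [← pow_add, ← pow_succ]; congr 2; omega

/-- Drazin's theorem: strongly pi-regular elements are Drazin invertible. -/
theorem strongly_pi_regular {R : Type*} [Ring R] {a u v : R} {n : ℕ}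
    (hu : a ^ n = a ^ (n + 1) * u) (hv : a ^ n = v * a ^ (n + 1)) :
    ∃ s : R, a * s = s * a ∧ s * a * s = s ∧ a ^ (n + 1) * s = a ^ n := by
  have key : ∀ i, v ^ i * a ^ n = a ^ n * u ^ i := fun i => by
    calc v ^ i * a ^ n = v ^ i * (a ^ (n + i) * u ^ i) := by rw [← pow_right_iter hu i]
      _ = (v ^ i * a ^ (n + i)) * u ^ i := by rw [mul_assoc]
      _ = a ^ n * u ^ i := by rw [← pow_left_iter hv i]
  have h1 : a * (a ^ n * u ^ (n + 1)) = a ^ n * u ^ n := by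
    calc a * (a ^ n * u ^ (n + 1)) = (a ^ (n + 1) * u) * u ^ n := by
          rw [pow_succ' a n, pow_succ' u n]; simp only [mul_assoc]
      _ = _ := by rw [← hu]
  have h2 : (a ^ n * u ^ (n + 1)) * a = a ^ n * u ^ n := by
    rw [← key, ← key]
    calc v ^ (n + 1) * a ^ n * a = v ^ n * (v * a ^ (n + 1)) := by
          rw [pow_succ a n, pow_succ v n]; simp only [mul_assoc]
      _ = _ := by rw [← hv]
  refine ⟨a ^ n * u ^ (n + 1), h1.trans h2.symm, ?_, ?_⟩
  · rw [h2, ← key]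
    calc v ^ n * a ^ n * (a ^ n * u ^ (n + 1)) = (v ^ n * a ^ (n + n)) * u ^ (n + 1) := by
          rw [pow_add a n n]; simp only [mul_assoc]
      _ = _ := by rw [← pow_left_iter hv n]
  · rw [← mul_assoc, ← pow_add, add_comm (n + 1) n]
    exact (pow_right_iter hu (n + 1)).symm

/-- If `m` has Drazin inverse `s`, then `m - μ` is a unit for small nonzero `μ`. -/
theorem drazin_isUnit {R : Type*} [Ring R] [Algebra ℂ R] {m s : R} {k : ℕ}
    (hc : m * s = s * m) (hk : m ^ (k + 1) * s = m ^ k) {μ : ℂ} (hμ : μ ≠ 0)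
    (hu : IsUnit (1 - μ • s)) : IsUnit (m - μ • (1 : R)) := by
  have hcm : Commute m s := hc
  have hcomm : Commute m (μ • (1 : R)) := (Commute.one_right m).smul_right μ
  obtain ⟨G, hG, hGm, hGs⟩ : ∃ G : R, (m - μ • (1 : R)) * G = m ^ k - μ ^ k • (1 : R) ∧
      Commute m G ∧ Commute s G := by
    refine ⟨∑ i ∈ Finset.range k, m ^ i * (μ • (1 : R)) ^ (k - 1 - i), ?_, ?_, ?_⟩
    · rw [hcomm.mul_geom_sum₂, smul_pow, one_pow]
    · refine Commute.sum_right _ _ _ fun i _ => ?_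
      exact ((Commute.refl m).pow_right i).mul_right (hcomm.pow_right _)
    · refine Commute.sum_right _ _ _ fun i _ => ?_
      exact (hcm.symm.pow_right i).mul_right (((Commute.one_right s).smul_right μ).pow_right _)
  have h0 : m ^ k * (1 - m * s) = 0 := by
    rw [mul_sub, mul_one, ← mul_assoc, ← pow_succ, hk, sub_self]
  have hprod : (m - μ • (1 : R)) * (s - (μ ^ k)⁻¹ • (G * (1 - m * s))) = 1 - μ • s := by
    rw [mul_sub, mul_smul_comm, ← mul_assoc, hG, sub_mul, sub_mul, h0, zero_sub, smul_neg,
      smul_mul_assoc, smul_mul_assoc, smul_smul, inv_mul_cancel₀ (pow_ne_zero k hμ), one_mul, one_mul, one_smul]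
    abel
  have hcc : Commute (m - μ • (1 : R)) (s - (μ ^ k)⁻¹ • (G * (1 - m * s))) := by
    have : Commute m (s - (μ ^ k)⁻¹ • (G * (1 - m * s))) := by
      refine hcm.sub_right (Commute.smul_right (hGm.mul_right ?_) _)
      exact (Commute.one_right m).sub_right ((Commute.refl m).mul_right hcm)
    exact this.sub_left ((Commute.one_left _).smul_left μ)
  rw [← hprod] at hu
  exact (hcc.isUnit_mul_iff.1 hu).1

/-- `1 - μ s` is eventually a unit. -/
theorem exists_ball_isUnit {R : Type*} [NormedRing R] [NormedAlgebra ℂ R] [CompleteSpace R]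
    (s : R) : ∃ r > (0 : ℝ), ∀ μ : ℂ, ‖μ‖ < r → IsUnit (1 - μ • s) := by
  have hcont : Continuous fun μ : ℂ => 1 - μ • s := by fun_prop
  have hopen : IsOpen ((fun μ : ℂ => 1 - μ • s) ⁻¹' {x | IsUnit x}) :=
    Units.isOpen.preimage hcont
  obtain ⟨r, hr, h⟩ := Metric.isOpen_iff.1 hopen 0 (by simp)
  exact ⟨r, hr, fun μ hμ => h (by simpa using hμ)⟩

/-- Drazin invertibility gives the SVEP. -/
theorem svep_of_drazin [CompleteSpace E] (T : E →L[ℂ] E) (z₀ : ℂ)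
    (h : IsDrazinInvertible (T - z₀ • 1)) : HasSVEPAt T z₀ := by
  obtain ⟨S, k, hc, -, hk⟩ := h
  obtain ⟨r, hr, hu⟩ := exists_ball_isUnit S
  refine ⟨r, hr, fun V hV hVo f hf hz => ?_⟩
  have hne : ∀ z ∈ V, z ≠ z₀ → f z = 0 := by
    intro z hzV hzne
    have hunit := drazin_isUnit hc hk (sub_ne_zero.2 hzne)
      (hu (z - z₀) (by simpa [dist_eq_norm] using hV hzV))
    have heq : T - z₀ • (1 : E →L[ℂ] E) - (z - z₀) • 1 = T - z • 1 := by
      rw [sub_smul]; abel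
    rw [heq] at hunit
    obtain ⟨w, hw⟩ := hunit.exists_left_inv
    have := congrArg (fun L : E →L[ℂ] E => L (f z)) hw
    simp only [mul_apply_eq_comp, hz z hzV, map_zero, one_apply_eq_self] at this
    exact this.symm
  intro z hzV
  by_cases hzz : z = z₀
  · subst hzz
    have hcont : Filter.Tendsto f (nhdsWithin z {z}ᶜ) (nhds (f z)) :=
      (hf z hzV).continuousAt.tendsto.mono_left nhdsWithin_le_nhds
    have h0 : Filter.Tendsto f (nhdsWithin z {z}ᶜ) (nhds 0) := by
      refine tendsto_const_nhds.congr' ?_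
      filter_upwards [self_mem_nhdsWithin, mem_nhdsWithin_of_mem_nhds (hVo.mem_nhds hzV)]
        with w hw hwV
      exact (hne w hwV hw).symm
    exact tendsto_nhds_unique hcont h0
  · exact hne z hzV hzz

/-- Finch: SVEP plus right invertibility gives injectivity. -/
theorem finch [CompleteSpace E] {T : E →L[ℂ] E} {z₀ : ℂ} (h : HasSVEPAt T z₀) :
    ∃ r > (0 : ℝ), ∀ w ∈ ball z₀ r, ∀ R : E →L[ℂ] E, (T - w • 1) * R = 1 →
      ∀ x, (T - w • 1) x = 0 → x = 0 := by
  obtain ⟨r, hr, h⟩ := h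
  refine ⟨r, hr, fun w hw R hR x hx => ?_⟩
  obtain ⟨δ, hδ, hu⟩ := exists_ball_isUnit R
  have hmem : ∀ z ∈ ball z₀ r ∩ ball w δ, IsUnit (1 - (z - w) • R) := fun z hz =>
    hu _ (by simpa [dist_eq_norm] using hz.2)
  have := h (ball z₀ r ∩ ball w δ) inter_subset_left (isOpen_ball.inter isOpen_ball)
    (fun z => Ring.inverse (1 - (z - w) • R) x) ?_ ?_ w ⟨hw, mem_ball_self hδ⟩
  · simpa using this
  · intro z hz
    have h1 : AnalyticAt ℂ (fun z : ℂ => Ring.inverse (1 - (z - w) • R)) z := by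
      have h2 : AnalyticAt ℂ (Ring.inverse : (E →L[ℂ] E) → _) (1 - (z - w) • R) := by
        have := analyticAt_inverse (𝕜 := ℂ) (hmem z hz).unit
        simpa using this
      have h3 : AnalyticAt ℂ (fun z : ℂ => 1 - (z - w) • R) z := by fun_prop
      exact AnalyticAt.comp (g := (Ring.inverse : (E →L[ℂ] E) → _)) (f := fun z : ℂ => 1 - (z - w) • R) h2 h3
    exact ((ContinuousLinearMap.apply ℂ E x).analyticAt _).fun_comp h1
  · intro z hz
    set g := Ring.inverse (1 - (z - w) • R) x with hg
    have h1 : (1 - (z - w) • R) g = x := by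
      rw [hg, ← mul_apply_eq_comp, Ring.mul_inverse_cancel _ (hmem z hz)]; rfl
    have h2 : g = x + (z - w) • R g := by
      rw [← h1]; simp
    have h3 : (T - w • 1) (R g) = g := by
      rw [← mul_apply_eq_comp, hR]; rfl
    have h4 : (T - w • 1) g = (z - w) • g := by
      conv_lhs => rw [h2]
      rw [map_add, hx, zero_add, map_smul, h3]
    have heq : T - z • (1 : E →L[ℂ] E) = (T - w • 1) - (z - w) • 1 := by
      rw [sub_smul]; abel
    change (T - z • 1) g = 0
    rw [heq, _root_.sub_apply, h4]; simp

/-- The Drazin inverse leaves invariant closed subspaces invariant under resolvents near `0`. -/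
theorem drazin_invariant [CompleteSpace E] {M S : E →L[ℂ] E} {k : ℕ}
    (hc : M * S = S * M) (hs : S * M * S = S) (hk : M ^ (k + 1) * S = M ^ k)
    (W : Set E) (hW : IsClosed W) (hM : ∀ v ∈ W, M v ∈ W) {r : ℝ} (hr : 0 < r)
    (hinv : ∀ μ : ℂ, μ ≠ 0 → ‖μ‖ < r → ∀ u, (M - μ • 1) u ∈ W → u ∈ W) :
    ∀ v ∈ W, S v ∈ W := by
  intro v hv
  obtain ⟨δ, hδ, hu⟩ := exists_ball_isUnit S
  have hcm : Commute M S := hc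
  have hMk : ∀ n, (M ^ n) v ∈ W := by
    intro n
    induction n with
    | zero => simpa using hv
    | succ n ih => rw [pow_succ', mul_apply_eq_comp]; exact hM _ ih
  have hSk : ∀ n, S ^ (n + 1) * M ^ n = S := by
    intro n
    induction n with
    | zero => simp
    | succ n ih =>
      calc S ^ (n + 1 + 1) * M ^ (n + 1) = S * (S ^ (n + 1) * M ^ n) * M := by
            rw [pow_succ' S (n + 1), pow_succ M n]; simp only [mul_assoc]
        _ = S * M * S := by rw [ih, mul_assoc S S M, mul_assoc S M S, hc]
        _ = S := hs
  have hstep : ∀ μ : ℂ, (1 - μ • S) ^ (k + 1) * M ^ k = (M - μ • 1) ^ (k + 1) * S := by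
    intro μ
    have hb : (1 - μ • S) * M ^ k = (M - μ • 1) * S * M ^ k := by
      rw [sub_mul, sub_mul, sub_mul, one_mul, smul_mul_assoc, smul_mul_assoc, one_mul]
      congr 1
      rw [mul_assoc, ← (hcm.pow_left k).eq, ← mul_assoc, ← pow_succ', hk]
    have hc1 : Commute (1 - μ • S) (M - μ • (1 : E →L[ℂ] E)) := by
      refine Commute.sub_left (Commute.one_left _) (Commute.smul_left ?_ μ)
      exact hcm.symm.sub_right ((Commute.one_right _).smul_right _)
    have hc2 : Commute (1 - μ • S) S :=
      (Commute.one_left _).sub_left ((Commute.refl S).smul_left μ)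
    have hc3 : Commute (M - μ • (1 : E →L[ℂ] E)) S :=
      hcm.sub_left ((Commute.one_left _).smul_left _)
    have hj : ∀ j, (1 - μ • S) ^ j * M ^ k = ((M - μ • 1) * S) ^ j * M ^ k := by
      intro j
      induction j with
      | zero => simp
      | succ j ih =>
        rw [pow_succ, mul_assoc, hb, ← mul_assoc, ((hc1.mul_right hc2).pow_left j).eq, mul_assoc, ih,
          ← mul_assoc, ← pow_succ']
    rw [hj, hc3.mul_pow, mul_assoc, hSk]
  let u : ℂ → E := fun μ => S (((Ring.inverse (1 - μ • S)) ^ (k + 1)) v)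
  have hlim : Filter.Tendsto u (nhdsWithin 0 {0}ᶜ) (nhds (S v)) := by
    have h1 : ContinuousAt (fun μ : ℂ => Ring.inverse (1 - μ • S)) 0 := by
      have h2 : ContinuousAt (Ring.inverse : (E →L[ℂ] E) → _) (1 - (0 : ℂ) • S) := by
        have := NormedRing.inverse_continuousAt (1 : (E →L[ℂ] E)ˣ)
        simpa using this
      have h3 : ContinuousAt (fun μ : ℂ => 1 - μ • S) 0 := by fun_prop
      exact ContinuousAt.comp' h2 h3
    have h4 : ContinuousAt u 0 := by
      have h5 := h1.pow (k + 1)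
      exact S.continuous.continuousAt.comp' (h5.clm_apply continuousAt_const)
    have h6 : u 0 = S v := by simp [u]
    rw [← h6]
    exact h4.tendsto.mono_left nhdsWithin_le_nhds
  refine hW.mem_of_tendsto hlim ?_
  filter_upwards [self_mem_nhdsWithin,
    mem_nhdsWithin_of_mem_nhds (Metric.ball_mem_nhds (0 : ℂ) hr),
    mem_nhdsWithin_of_mem_nhds (Metric.ball_mem_nhds (0 : ℂ) hδ)] with μ hμ hμr hμδ
  have hμr' : ‖μ‖ < r := by simpa using hμr
  have hunit := hu μ (by simpa using hμδ)
  have hdesc : ∀ j (x : E), ((M - μ • (1 : E →L[ℂ] E)) ^ j) x ∈ W → x ∈ W := by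
    intro j
    induction j with
    | zero => intro x hx; simpa using hx
    | succ j ih =>
      intro x hx
      rw [pow_succ', mul_apply_eq_comp] at hx
      exact ih _ (hinv μ hμ hμr' _ hx)
  apply hdesc (k + 1)
  have hq : (M - μ • 1) ^ (k + 1) * S * (Ring.inverse (1 - μ • S)) ^ (k + 1) = M ^ k := by
    have hc4 : Commute (1 - μ • S) (M ^ k) :=
      (Commute.one_left _).sub_left ((hcm.symm.pow_right k).smul_left μ)
    have hc5 : Commute (1 - μ • S) (Ring.inverse (1 - μ • S)) := by
      change _ * _ = _ * _
      rw [Ring.mul_inverse_cancel _ hunit, Ring.inverse_mul_cancel _ hunit]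
    rw [← hstep, (hc4.pow_left _).eq, mul_assoc, ← hc5.mul_pow, Ring.mul_inverse_cancel _ hunit,
      one_pow, mul_one]
  have : ((M - μ • 1) ^ (k + 1)) (u μ) = (M ^ k) v := by rw [← hq]; rfl
  rw [this]
  exact hMk k

theorem ucMat_apply (A : X →L[ℂ] X) (B : Y →L[ℂ] Y) (C : Y →L[ℂ] X) (p : X × Y) :
    ucMat A B C p = (A p.1 + C p.2, B p.2) := rfl

theorem ucMat_sub (A : X →L[ℂ] X) (B : Y →L[ℂ] Y) (C : Y →L[ℂ] X) (z : ℂ) :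
    ucMat A B C - z • 1 = ucMat (A - z • 1) (B - z • 1) C := by
  ext p <;> simp [ucMat_apply]

theorem ucMat_mul (A A' : X →L[ℂ] X) (B B' : Y →L[ℂ] Y) (C C' : Y →L[ℂ] X) :
    ucMat A B C * ucMat A' B' C' = ucMat (A * A') (B * B') (A.comp C' + C.comp B') := by
  ext p <;> simp [ucMat_apply]

theorem ucMat_pow (A : X →L[ℂ] X) (B : Y →L[ℂ] Y) (C : Y →L[ℂ] X) (n : ℕ) :
    ∃ D, ucMat A B C ^ n = ucMat (A ^ n) (B ^ n) D := by
  induction n with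
  | zero => exact ⟨0, by ext p <;> simp [ucMat_apply]⟩
  | succ n ih =>
    obtain ⟨D, hD⟩ := ih
    exact ⟨_, by rw [pow_succ, hD, ucMat_mul, ← pow_succ, ← pow_succ]⟩

theorem ucMat_inj {A A' : X →L[ℂ] X} {B B' : Y →L[ℂ] Y} {C C' : Y →L[ℂ] X}
    (h : ucMat A B C = ucMat A' B' C') : A = A' ∧ B = B' := by
  constructor
  · ext x
    simpa [ucMat_apply] using congrArg (fun L : X × Y →L[ℂ] X × Y => (L (x, 0)).1) h
  · ext y
    simpa [ucMat_apply] using congrArg (fun L : X × Y →L[ℂ] X × Y => (L (0, y)).2) h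

theorem ucMat_of_invariant (S : X × Y →L[ℂ] X × Y) (h : ∀ x, (S (x, 0)).2 = 0) :
    ∃ A B C, S = ucMat A B C := by
  refine ⟨(ContinuousLinearMap.fst ℂ X Y).comp (S.comp (ContinuousLinearMap.inl ℂ X Y)),
    (ContinuousLinearMap.snd ℂ X Y).comp (S.comp (ContinuousLinearMap.inr ℂ X Y)),
    (ContinuousLinearMap.fst ℂ X Y).comp (S.comp (ContinuousLinearMap.inr ℂ X Y)), ?_⟩
  have h00 : S (0, 0) = 0 := S.map_zero
  ext p <;> simp [ucMat_apply, h, h00]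

/-- A Drazin inverse which is upper triangular gives Drazin inverses of the diagonal. -/
theorem drazin_diag {A : X →L[ℂ] X} {B : Y →L[ℂ] Y} {C : Y →L[ℂ] X}
    {S : X × Y →L[ℂ] X × Y} {k : ℕ} (hc : ucMat A B C * S = S * ucMat A B C)
    (hs : S * ucMat A B C * S = S) (hk : ucMat A B C ^ (k + 1) * S = ucMat A B C ^ k)
    (h : ∀ x, (S (x, 0)).2 = 0) : IsDrazinInvertible A ∧ IsDrazinInvertible B := by
  obtain ⟨P, Q, D, rfl⟩ := ucMat_of_invariant S h
  obtain ⟨D1, h1⟩ := ucMat_pow A B C (k + 1)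
  obtain ⟨D2, h2⟩ := ucMat_pow A B C k
  rw [h1, h2, ucMat_mul] at hk
  rw [ucMat_mul, ucMat_mul] at hc hs
  have a := ucMat_inj hc
  have b := ucMat_inj hs
  have c := ucMat_inj hk
  exact ⟨⟨P, k, a.1, b.1, c.1⟩, ⟨Q, k, a.2, b.2, c.2⟩⟩

/-- Raising the index. -/
theorem drazin_index_le {R : Type*} [Ring R] {a s : R} {k n : ℕ}
    (hk : a ^ (k + 1) * s = a ^ k) (hn : k ≤ n) : a ^ (n + 1) * s = a ^ n := by
  obtain ⟨j, rfl⟩ := Nat.exists_eq_add_of_le hn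
  rw [add_comm k j, add_assoc, pow_add, mul_assoc, hk, ← pow_add]

theorem drazin_ucMat {A : X →L[ℂ] X} {B : Y →L[ℂ] Y} (C : Y →L[ℂ] X)
    (hA : IsDrazinInvertible A) (hB : IsDrazinInvertible B) :
    IsDrazinInvertible (ucMat A B C) := by
  obtain ⟨S, k₁, hSc, -, hk₁⟩ := hA
  obtain ⟨T, k₂, hTc, -, hk₂⟩ := hB
  obtain ⟨k, hk1, hk2⟩ : ∃ k, k₁ ≤ k ∧ k₂ ≤ k := ⟨max k₁ k₂, le_max_left _ _, le_max_right _ _⟩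
  have hS := drazin_index_le hk₁ hk1
  have hT := drazin_index_le hk₂ hk2
  have hS' : S * A ^ (k + 1) = A ^ k := by
    rw [← hS]; exact ((show Commute A S from hSc).pow_left (k + 1)).eq.symm
  have hT' : T * B ^ (k + 1) = B ^ k := by
    rw [← hT]; exact ((show Commute B T from hTc).pow_left (k + 1)).eq.symm
  obtain ⟨D0, h0⟩ := ucMat_pow A B C k
  obtain ⟨D1, h1⟩ := ucMat_pow A B C (k + 1)
  set M := ucMat A B C with hM
  have hstrict : ∀ (P : X →L[ℂ] X) (Q : Y →L[ℂ] Y) (D D' : Y →L[ℂ] X),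
      ucMat P Q D - ucMat P Q D' = ucMat 0 0 (D - D') := by
    intro P Q D D'
    ext p <;> simp [ucMat_apply]
  obtain ⟨F, hF⟩ : ∃ F, M ^ k = M ^ (k + 1) * ucMat S T 0 + ucMat 0 0 F := by
    simp only [← sub_eq_iff_eq_add']
    rw [h0, h1, ucMat_mul, hS, hT, hstrict]
    exact ⟨_, rfl⟩
  obtain ⟨G, hG⟩ : ∃ G, M ^ k = ucMat S T 0 * M ^ (k + 1) + ucMat 0 0 G := by
    simp only [← sub_eq_iff_eq_add']
    rw [h0, h1, ucMat_mul, hS', hT', hstrict]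
    exact ⟨_, rfl⟩
  obtain ⟨D2, h2⟩ := ucMat_pow A B C (k + k + 1)
  rw [← hM] at h2
  have e1 : M ^ k * ucMat 0 0 F = M ^ (k + k + 1) * ucMat 0 0 ((S ^ (k + 1)).comp F) := by
    have := pow_right_iter hS.symm (k + 1)
    rw [h0, h2, ucMat_mul, ucMat_mul]
    simp only [mul_zero, ContinuousLinearMap.comp_zero, add_zero]
    congr 1
    rw [← ContinuousLinearMap.comp_assoc]
    congr 1
  have e2 : ucMat 0 0 G * M ^ k = ucMat 0 0 (G.comp (T ^ (k + 1))) * M ^ (k + k + 1) := by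
    have := pow_left_iter hT'.symm (k + 1)
    rw [h0, h2, ucMat_mul, ucMat_mul]
    simp only [zero_mul, ContinuousLinearMap.zero_comp, zero_add]
    congr 1
    rw [ContinuousLinearMap.comp_assoc]
    congr 1
  have f1 : M ^ (k + k) = M ^ (k + k + 1) * (ucMat S T 0 + ucMat 0 0 ((S ^ (k + 1)).comp F)) := by
    rw [mul_add, ← e1, add_assoc k k 1, pow_add M k (k + 1), mul_assoc, ← mul_add, ← hF, pow_add]
  have f2 : M ^ (k + k) = (ucMat S T 0 + ucMat 0 0 (G.comp (T ^ (k + 1)))) * M ^ (k + k + 1) := by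
    rw [add_mul, ← e2, add_right_comm k k 1, pow_add M (k + 1) k, ← mul_assoc, ← add_mul, ← hG,
      pow_add]
  obtain ⟨s, hs⟩ := strongly_pi_regular f1 f2
  exact ⟨s, _, hs⟩

/-- The converse direction under one of the SVEP hypotheses. -/
theorem drazin_of_ucMat (A : X →L[ℂ] X) (B : Y →L[ℂ] Y) (C : Y →L[ℂ] X) (z : ℂ)
    (hM : IsDrazinInvertible (ucMat A B C - z • 1))
    (h : HasSVEPAt (dualOp A) z ∨ HasSVEPAt B z) :
    IsDrazinInvertible (A - z • 1) ∧ IsDrazinInvertible (B - z • 1) := by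
  obtain ⟨S, k, hc, hs, hk⟩ := hM
  obtain ⟨δ, hδ, hu⟩ := exists_ball_isUnit S
  have hshift : ∀ (μ : ℂ), ucMat A B C - z • 1 - μ • 1 =
      ucMat (A - (z + μ) • 1) (B - (z + μ) • 1) C := by
    intro μ
    rw [← ucMat_sub, add_smul]; abel
  have hunit : ∀ μ : ℂ, μ ≠ 0 → ‖μ‖ < δ →
      IsUnit (ucMat (A - (z + μ) • 1) (B - (z + μ) • 1) C) := fun μ h0 h1 => by
    rw [← hshift]; exact drazin_isUnit hc hk h0 (hu μ h1)
  have main : ∃ r > 0, ∀ μ : ℂ, μ ≠ 0 → ‖μ‖ < r → ∀ u,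
      (ucMat A B C - z • 1 - μ • 1) u ∈ {p : X × Y | p.2 = 0} → u ∈ {p : X × Y | p.2 = 0} := by
    rcases h with h | h
    · obtain ⟨r, hr, hf⟩ := finch h
      refine ⟨min r δ, lt_min hr hδ, fun μ h0 h1 u hu' => ?_⟩
      have hU := hunit μ h0 (h1.trans_le (min_le_right _ _))
      obtain ⟨R, hR⟩ := hU.exists_left_inv
      rw [hshift] at hu'
      set A' := A - (z + μ) • (1 : X →L[ℂ] X) with hA'
      set B' := B - (z + μ) • (1 : Y →L[ℂ] Y) with hB'
      let L : X →L[ℂ] X :=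
        (ContinuousLinearMap.fst ℂ X Y).comp (R.comp (ContinuousLinearMap.inl ℂ X Y))
      have hRa : ∀ p, R (ucMat A' B' C p) = p := fun p => by
        rw [← mul_apply_eq_comp, hR]; rfl
      have hL : ∀ x, L (A' x) = x := fun x => by
        have := congrArg Prod.fst (hRa (x, 0))
        simpa [ucMat_apply, L] using this
      have hdual : ∀ φ : X →L[ℂ] ℂ, (dualOp A - (z + μ) • 1) φ = φ.comp A' := by
        intro φ
        ext x
        change φ (A x) - (z + μ) • φ x = φ (A x - (z + μ) • x)
        rw [map_sub, map_smul]
      have hinj := hf (z + μ) (by simpa [dist_eq_norm] using h1.trans_le (min_le_left _ _))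
        (dualOp L) (by
          ext φ x
          rw [mul_apply_eq_comp, hdual]
          change φ (L (A' x)) = φ x
          rw [hL])
      have hAL : ∀ x, A' (L x) = x := by
        intro x
        by_contra hne
        obtain ⟨φ, hφ⟩ := SeparatingDual.exists_ne_zero (R := ℂ) (sub_ne_zero.2 hne)
        have hz := hinj (φ.comp (A'.comp L - 1)) (by
          rw [hdual]
          ext y
          simp [hL])
        apply hφ
        simpa using congrArg (fun ψ : X →L[ℂ] ℂ => ψ x) hz
      have hu2 : (ucMat A' B' C u).2 = 0 := hu'
      have heq : ucMat A' B' C (L (ucMat A' B' C u).1, 0) = ucMat A' B' C u := by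
        rw [ucMat_apply A' B' C (L (ucMat A' B' C u).1, 0)]
        refine Prod.ext ?_ ?_
        · simp [hAL]
        · simp [hu2]
      have := congrArg R heq
      rw [hRa, hRa] at this
      rw [← this]; rfl
    · obtain ⟨r, hr, hf⟩ := finch h
      refine ⟨min r δ, lt_min hr hδ, fun μ h0 h1 u hu' => ?_⟩
      have hU := hunit μ h0 (h1.trans_le (min_le_right _ _))
      obtain ⟨R, hR⟩ := hU.exists_right_inv
      rw [hshift] at hu'
      refine hf (z + μ) (by simpa [dist_eq_norm] using h1.trans_le (min_le_left _ _))
        ((ContinuousLinearMap.snd ℂ X Y).comp (R.comp (ContinuousLinearMap.inr ℂ X Y))) ?_ _ hu'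
      refine ContinuousLinearMap.ext fun y => ?_
      exact congrArg (fun L : X × Y →L[ℂ] X × Y => (L (0, y)).2) hR
  obtain ⟨r, hr, hmain⟩ := main
  have hinvS := drazin_invariant hc hs hk {p : X × Y | p.2 = 0}
    (isClosed_eq continuous_snd continuous_const)
    (fun v hv => by
      have hv' : v.2 = 0 := hv
      rw [ucMat_sub]
      simp [ucMat_apply, hv']) hr hmain
  rw [ucMat_sub] at hc hs hk
  exact drazin_diag hc hs hk fun x => hinvS (x, 0) rfl

theorem stmt6 (A : X →L[ℂ] X) (B : Y →L[ℂ] Y) (C : Y →L[ℂ] X) :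
    drazinSpectrum (ucMat A B C) ∪ (svepFail (dualOp A) ∩ svepFail B) =
      drazinSpectrum A ∪ drazinSpectrum B := by
  ext z
  simp only [drazinSpectrum, svepFail, mem_union, mem_inter_iff, mem_ofPred_eq]
  constructor
  · intro h
    by_contra hcon
    push Not at hcon
    obtain ⟨hA, hB⟩ := hcon
    rcases h with h | ⟨-, h⟩
    · apply h
      rw [ucMat_sub]
      exact drazin_ucMat C hA hB
    · exact h (svep_of_drazin B z hB)
  · intro h
    by_contra hcon
    rw [not_or, not_not, not_and_or, not_not, not_not] at hcon
    have := drazin_of_ucMat A B C z hcon.1 hcon.2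
    rcases h with h | h
    · exact h this.1
    · exact h this.2
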